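/- Let K be a difference subfield of U with σ(K) = K, and let a, b be finite tuples from U such that σ(a) and b lie in K(a)^alg and σ(b) ∈ K(b)^alg. Then ld((a,b)/K)·ild(a/K) = ild((a,b)/K)·ld(a/K). -/

import Mathlib

/- Setting: a large algebraically closed field `U` with an automorphism `σ`.
   Tuples are maps `Fin n → U`; for a tuple `t`, the relevant set of coordinates
   is `Set.range t`.  `fAdj E s` is the subfield `E(s)` generated by a subfield
   `E` and a set `s`, and `deg E s` is the degree `μ(s/E) = [E(s):E]`. -/

set_option maxHeartbeats 1000000
set_option synthInstance.maxHeartbeats 1000000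

open Filter Set

variable {U : Type*}

/-- The subfield `E(s)` generated by the subfield `E` and the set `s`. -/
noncomputable def fAdj [Field U] (E : Subfield U) (s : Set U) : Subfield U :=
  (IntermediateField.adjoin E s).toSubfield

/-- The degree `μ(s/E) = [E(s):E]` (as `Module.finrank`; it is `0` when infinite). -/
noncomputable def deg [Field U] (E : Subfield U) (s : Set U) : ℕ :=
  Module.finrank E (IntermediateField.adjoin E s)

/-- `k ↦ μ(σ^{k+1}(s) / K(s, σ(s), …, σ^k(s)))`: the sequence whose eventual
value is the limit degree `ld(s/K)`. -/
noncomputable def ldSeq [Field U] (σ : U ≃+* U) (K : Subfield U) (s : Set U) (k : ℕ) : ℕ :=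
  deg (fAdj K (⋃ i ∈ Set.Iic k, ⇑(σ ^ i) '' s)) (⇑(σ ^ (k + 1)) '' s)

/-- `k ↦ μ(σ^k(s) / K(s))`: the sequence whose `k`-th roots converge to the
distant degree `dd(s/K)`. -/
noncomputable def ddSeq [Field U] (σ : U ≃+* U) (K : Subfield U) (s : Set U) (k : ℕ) : ℕ :=
  deg (fAdj K s) (⇑(σ ^ k) '' s)

/-- The inversive closure `K^inv = ⋃ₙ σ^{-n}(K)`. -/
noncomputable def Kinv [Field U] (σ : U ≃+* U) (K : Subfield U) : Subfield U :=
  ⨆ n : ℕ, K.map (σ⁻¹ ^ n : U ≃+* U).toRingHom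

/-- The difference field `K(s)_σ = K(σ^i(s) : i ∈ ℕ)` generated by `s` over `K`. -/
noncomputable def diffAdj [Field U] (σ : U ≃+* U) (K : Subfield U) (s : Set U) : Subfield U :=
  fAdj K (⋃ i : ℕ, ⇑(σ ^ i) '' s)

theorem fAdj_eq_sup [Field U] (E : Subfield U) (s : Set U) :
    fAdj E s = E ⊔ Subfield.closure s := by
  rw [fAdj, IntermediateField.adjoin_toSubfield, Subfield.closure_union]
  congr 1
  refine (congrArg Subfield.closure ?_).trans (Subfield.closure_eq E)
  ext x
  simp [Subfield.algebraMap_ofSubfield]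

theorem fAdj_union [Field U] (E : Subfield U) (s t : Set U) :
    fAdj E (s ∪ t) = fAdj (fAdj E s) t := by
  simp only [fAdj_eq_sup, Subfield.closure_union, sup_assoc]

theorem le_fAdj [Field U] (E : Subfield U) (s : Set U) : E ≤ fAdj E s := by
  rw [fAdj_eq_sup]
  exact le_sup_left

theorem fAdj_mono [Field U] (E : Subfield U) {s t : Set U} (h : s ⊆ t) :
    fAdj E s ≤ fAdj E t := by
  simp only [fAdj_eq_sup]
  exact sup_le_sup_left (Subfield.closure_mono h) E

theorem map_fAdj [Field U] (E : Subfield U) (s : Set U) (f : U →+* U) :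
    (fAdj E s).map f = fAdj (E.map f) (f '' s) := by
  simp only [fAdj_eq_sup, Subfield.map_sup, RingHom.map_field_closure]

theorem deg_eq_relfinrank [Field U] (E : Subfield U) (s : Set U) :
    deg E s = E.relfinrank (fAdj E s) := by
  rw [Subfield.relfinrank_eq_finrank_of_le (le_fAdj E s)]
  rfl

theorem deg_ne_zero [Field U] {E : Subfield U} {s : Set U} (hs : s.Finite)
    (h : ∀ x ∈ s, IsAlgebraic E x) : deg E s ≠ 0 := by
  have : Finite s := hs
  have := IntermediateField.finiteDimensional_adjoin (fun x hx => (h x hx).isIntegral)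
  exact Module.finrank_pos.ne'

theorem map_pow_eq_self [Field U] {σ : U ≃+* U} {K : Subfield U}
    (hK : K.map σ.toRingHom = K) (k : ℕ) : K.map (σ ^ k : U ≃+* U).toRingHom = K := by
  induction k with
  | zero => exact SetLike.coe_injective (Set.image_id _)
  | succ k ih =>
    calc K.map (σ ^ (k + 1) : U ≃+* U).toRingHom
        = (K.map σ.toRingHom).map (σ ^ k : U ≃+* U).toRingHom := by
          rw [Subfield.map_map, pow_succ]
          rfl
      _ = K := by rw [hK, ih]

theorem map_inv_eq_self [Field U] {σ : U ≃+* U} {K : Subfield U}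
    (hK : K.map σ.toRingHom = K) : K.map (σ⁻¹ : U ≃+* U).toRingHom = K := by
  conv_lhs => rw [← hK]
  exact SetLike.coe_injective (σ.toEquiv.symm_image_image K)

theorem Kinv_eq_self [Field U] {σ : U ≃+* U} {K : Subfield U}
    (hK : K.map σ.toRingHom = K) : Kinv σ K = K := by
  simp only [Kinv, map_pow_eq_self (map_inv_eq_self hK), iSup_const]

/-- The subfield `K(s, σ(s), …, σ^k(s))`. -/
noncomputable def orbitAdj [Field U] (σ : U ≃+* U) (K : Subfield U) (s : Set U) (k : ℕ) :
    Subfield U :=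
  fAdj K (⋃ i ∈ Set.Iic k, ⇑(σ ^ i) '' s)

theorem orbitAdj_succ [Field U] (σ : U ≃+* U) (K : Subfield U) (s : Set U) (k : ℕ) :
    orbitAdj σ K s (k + 1) = fAdj (orbitAdj σ K s k) (⇑(σ ^ (k + 1)) '' s) := by
  rw [orbitAdj, orbitAdj, ← fAdj_union]
  congr 1
  ext x
  simp only [mem_union, mem_iUnion, mem_Iic, exists_prop, Nat.le_succ_iff, or_and_right,
    exists_or, exists_eq_left]

theorem orbitAdj_mono [Field U] (σ : U ≃+* U) (K : Subfield U) {s t : Set U} (h : s ⊆ t)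
    (k : ℕ) : orbitAdj σ K s k ≤ orbitAdj σ K t k :=
  fAdj_mono K (iUnion₂_mono fun _ _ => image_mono h)

theorem orbitAdj_le_succ [Field U] (σ : U ≃+* U) (K : Subfield U) (s : Set U) (k : ℕ) :
    orbitAdj σ K s k ≤ orbitAdj σ K s (k + 1) := by
  rw [orbitAdj_succ]
  exact le_fAdj _ _

theorem ldSeq_eq_relfinrank [Field U] (σ : U ≃+* U) (K : Subfield U) (s : Set U) (k : ℕ) :
    ldSeq σ K s k = (orbitAdj σ K s k).relfinrank (orbitAdj σ K s (k + 1)) := by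
  rw [orbitAdj_succ, ← deg_eq_relfinrank]
  rfl

theorem map_orbitAdj_inv [Field U] {σ : U ≃+* U} {K : Subfield U}
    (hK : K.map σ.toRingHom = K) (s : Set U) (k : ℕ) :
    (orbitAdj σ⁻¹ K s k).map (σ ^ k : U ≃+* U).toRingHom = orbitAdj σ K s k := by
  rw [orbitAdj, orbitAdj, map_fAdj, map_pow_eq_self hK]
  congr 1
  have key {i j : ℕ} (h : i + j = k) (x : U) : (σ ^ k) ((σ⁻¹ ^ i) x) = (σ ^ j) x := by
    have : σ ^ k * σ⁻¹ ^ i = σ ^ j := by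
      rw [← h, add_comm, pow_add, mul_assoc, inv_pow, mul_inv_cancel, mul_one]
    exact DFunLike.congr_fun this x
  ext x
  simp only [mem_image, mem_iUnion, mem_Iic, exists_prop]
  constructor
  · rintro ⟨_, ⟨i, hi, y, hy, rfl⟩, rfl⟩
    exact ⟨k - i, Nat.sub_le k i, y, hy, (key (Nat.add_sub_cancel' hi) y).symm⟩
  · rintro ⟨j, hj, y, hy, rfl⟩
    exact ⟨_, ⟨k - j, Nat.sub_le k j, y, hy, rfl⟩, key (Nat.sub_add_cancel hj) y⟩

theorem ldSeq_inv_eq_relfinrank [Field U] {σ : U ≃+* U} {K : Subfield U}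
    (hK : K.map σ.toRingHom = K) (s : Set U) (k : ℕ) :
    ldSeq σ⁻¹ K s k =
      ((orbitAdj σ K s k).map σ.toRingHom).relfinrank (orbitAdj σ K s (k + 1)) := by
  rw [ldSeq_eq_relfinrank,
    ← Subfield.relfinrank_map_map _ _ (σ ^ (k + 1) : U ≃+* U).toRingHom, map_orbitAdj_inv hK,
    ← map_orbitAdj_inv hK s k, Subfield.map_map, pow_succ' σ k]
  rfl

theorem map_orbitAdj_le_succ [Field U] {σ : U ≃+* U} {K : Subfield U}
    (hK : K.map σ.toRingHom = K) (s : Set U) (k : ℕ) :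
    (orbitAdj σ K s k).map σ.toRingHom ≤ orbitAdj σ K s (k + 1) := by
  rw [orbitAdj, map_fAdj, hK]
  refine fAdj_mono K ?_
  rintro _ ⟨x, hx, rfl⟩
  simp only [mem_iUnion, mem_Iic, exists_prop] at hx ⊢
  obtain ⟨i, hi, y, hy, rfl⟩ := hx
  exact ⟨i + 1, Nat.succ_le_succ hi, y, hy, by rw [pow_succ']; rfl⟩

theorem isAlgebraic_apply [Field U] {E F : Subfield U} (f : U →+* U) (h : E.map f ≤ F) {x : U}
    (hx : IsAlgebraic E x) : IsAlgebraic F (f x) := by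
  let g : E →+* F := (f.comp E.subtype).codRestrict F fun y => h ⟨y, y.2, rfl⟩
  exact hx.ringHom_of_comp_eq g f g.injective rfl

theorem relfinrank_orbitAdj_union_ne_zero [Field U] {σ : U ≃+* U} {K : Subfield U}
    (hK : K.map σ.toRingHom = K) {s t : Set U} (ht : t.Finite)
    (h : ∀ x ∈ t, IsAlgebraic (fAdj K s) x) (k : ℕ) :
    (orbitAdj σ K s k).relfinrank (orbitAdj σ K (s ∪ t) k) ≠ 0 := by
  have hunion : orbitAdj σ K (s ∪ t) k =
      fAdj (orbitAdj σ K s k) (⋃ i ∈ Set.Iic k, ⇑(σ ^ i) '' t) := by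
    simp only [orbitAdj, ← fAdj_union, image_union, iUnion_union_distrib]
  rw [hunion, ← deg_eq_relfinrank]
  refine deg_ne_zero ((finite_Iic k).biUnion fun i _ => ht.image _) fun x hx => ?_
  simp only [mem_iUnion, exists_prop] at hx
  obtain ⟨i, hi, y, hy, rfl⟩ := hx
  refine isAlgebraic_apply (σ ^ i : U ≃+* U).toRingHom ?_ (h y hy)
  rw [map_fAdj, map_pow_eq_self hK]
  exact fAdj_mono K (subset_biUnion_of_mem (u := fun i => ⇑(σ ^ i) '' s) hi)

/-- `ld((a,b)/K)·ild(a/K) = ild((a,b)/K)·ld(a/K)`.  The limit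
degrees are the eventual values of `ldSeq`, and the inverse (limit) degrees
are the corresponding quantities for `σ⁻¹` over `K^inv`. -/
theorem stmt1 [Field U] [IsAlgClosed U] (σ : U ≃+* U) (K : Subfield U)
    (hK : K.map σ.toRingHom = K) {n m : ℕ} (a : Fin n → U) (b : Fin m → U)
    (ha : ∀ i, IsAlgebraic (fAdj K (Set.range a)) (σ (a i)))
    (hba : ∀ j, IsAlgebraic (fAdj K (Set.range a)) (b j))
    (hb : ∀ j, IsAlgebraic (fAdj K (Set.range b)) (σ (b j)))
    (Lab La Iab Ia : ℕ)
    (hLab : ∀ᶠ k in atTop, ldSeq σ K (Set.range a ∪ Set.range b) k = Lab)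
    (hLa : ∀ᶠ k in atTop, ldSeq σ K (Set.range a) k = La)
    (hIab : ∀ᶠ k in atTop, ldSeq σ⁻¹ (Kinv σ K) (Set.range a ∪ Set.range b) k = Iab)
    (hIa : ∀ᶠ k in atTop, ldSeq σ⁻¹ (Kinv σ K) (Set.range a) k = Ia) :
    Lab * Ia = Iab * La := by
  rw [Kinv_eq_self hK] at hIab hIa
  obtain ⟨k, h₁, h₂, h₃, h₄⟩ := (hLab.and (hLa.and (hIab.and hIa))).exists
  rw [ldSeq_eq_relfinrank] at h₁ h₂
  rw [ldSeq_inv_eq_relfinrank hK] at h₃ h₄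
  have hd := relfinrank_orbitAdj_union_ne_zero hK (Set.finite_range b)
    (Set.forall_mem_range.2 hba)
  set A := orbitAdj σ K (Set.range a)
  set B := orbitAdj σ K (Set.range a ∪ Set.range b)
  have hAB : ∀ j, A j ≤ B j := orbitAdj_mono σ K Set.subset_union_left
  have e₁ : (A k).relfinrank (B k) * Lab = La * (A (k + 1)).relfinrank (B (k + 1)) := by
    rw [← h₁, ← h₂, Subfield.relfinrank_mul_relfinrank (hAB k) (orbitAdj_le_succ σ K _ k),
      Subfield.relfinrank_mul_relfinrank (orbitAdj_le_succ σ K _ k) (hAB (k + 1))]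
  have e₂ : (A k).relfinrank (B k) * Iab = Ia * (A (k + 1)).relfinrank (B (k + 1)) := by
    rw [← h₃, ← h₄, ← Subfield.relfinrank_map_map (A k) (B k) σ.toRingHom,
      Subfield.relfinrank_mul_relfinrank ((Subfield.gc_map_comap _).monotone_l (hAB k))
        (map_orbitAdj_le_succ hK _ k),
      Subfield.relfinrank_mul_relfinrank (map_orbitAdj_le_succ hK _ k) (hAB (k + 1))]
  refine Nat.eq_of_mul_eq_mul_left (Nat.pos_of_ne_zero (mul_ne_zero (hd k) (hd (k + 1)))) ?_
  linear_combination (A (k + 1)).relfinrank (B (k + 1)) * Ia * e₁ -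
    (A (k + 1)).relfinrank (B (k + 1)) * La * e₂
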